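/- arXiv:1711.05994 — 2 statements merged into one kernel-verified Lean document; each statement's English description precedes it below -/
import Mathlib

section
/- Let A be a WFA over a finite alphabet Σ and let B = ⟨β₀, β_∞, {B_σ}⟩ be a minimal WFA computing the function f_A², i.e. f_B(x) = f_A(x)² for all x. Then f_A ∈ ℓ²(Σ) if and only if the spectral radius of Σ_{σ∈Σ} B_σ is strictly less than 1. -/
open scoped ENNReal
open scoped Kronecker
open Matrix

noncomputable section

/-- A weighted finite automaton of dimension `n` over alphabet `S`,
with initial weights, final weights and transition matrices. -/
structure WFA (S : Type*) (n : ℕ) where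
  init : Fin n → ℝ
  final : Fin n → ℝ
  trans : S → Matrix (Fin n) (Fin n) ℝ

namespace WFA

variable {S : Type*} {n : ℕ}

/-- `A_x = A_{x₁} ⋯ A_{x_t}` (identity for the empty string). -/
def matOf (M : WFA S n) (x : List S) : Matrix (Fin n) (Fin n) ℝ :=
  (x.map M.trans).prod

/-- The function computed by the WFA: `f_A(x) = αᵀ A_x β`. -/
def f (M : WFA S n) (x : List S) : ℝ :=
  M.init ⬝ᵥ (M.matOf x).mulVec M.final

/-- Row `p` of the forward matrix: `αᵀ A_p`. -/
def fwd (M : WFA S n) (x : List S) : Fin n → ℝ :=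
  Matrix.vecMul M.init (M.matOf x)

/-- Row `s` of the backward matrix: `(A_s β)ᵀ`. -/
def bwd (M : WFA S n) (x : List S) : Fin n → ℝ :=
  (M.matOf x).mulVec M.final

/-- `M` is a minimal WFA: no WFA of strictly smaller dimension computes the same function. -/
def Min (M : WFA S n) : Prop :=
  ∀ m : ℕ, (∃ B : WFA S m, B.f = M.f) → n ≤ m

/-- The reachability Gramian `G_p = Pᵀ P` is well-defined: all its defining sums converge. -/
def GpDefined (M : WFA S n) : Prop :=
  ∀ i j, Summable fun x : List S => M.fwd x i * M.fwd x j

/-- The observability Gramian `G_s = Sᵀ S` is well-defined: all its defining sums converge. -/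
def GsDefined (M : WFA S n) : Prop :=
  ∀ i j, Summable fun x : List S => M.bwd x i * M.bwd x j

/-- The reachability Gramian `G_p = Pᵀ P`. -/
def Gp (M : WFA S n) : Matrix (Fin n) (Fin n) ℝ :=
  Matrix.of fun i j => ∑' x : List S, M.fwd x i * M.fwd x j

/-- The observability Gramian `G_s = Sᵀ S`. -/
def Gs (M : WFA S n) : Matrix (Fin n) (Fin n) ℝ :=
  Matrix.of fun i j => ∑' x : List S, M.bwd x i * M.bwd x j

/-- Truncation of a WFA to its first `m` states. -/
def trunc (M : WFA S n) (m : ℕ) (h : m ≤ n) : WFA S m where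
  init := fun i => M.init (Fin.castLE h i)
  final := fun i => M.final (Fin.castLE h i)
  trans := fun a => Matrix.of fun i j => M.trans a (Fin.castLE h i) (Fin.castLE h j)

end WFA

/-- A function `f : Σ* → ℝ` is rational if it is computed by some WFA. -/
def IsRational {S : Type*} (f : List S → ℝ) : Prop :=
  ∃ (n : ℕ) (M : WFA S n), M.f = f

/-- Spectral radius of a real square matrix: the largest modulus of its complex eigenvalues. -/
def specRad {d : Type*} [Fintype d] [DecidableEq d] (M : Matrix d d ℝ) : ℝ≥0∞ :=
  spectralRadius ℂ (M.map (algebraMap ℝ ℂ))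

/-- Induced ∞-norm of a matrix: maximum absolute row sum. -/
def normInfM {d e : Type*} [Fintype d] [Fintype e] (M : Matrix d e ℝ) : ℝ :=
  ⨆ i, ∑ j, |M i j|

/-- Induced 1-norm of a matrix: maximum absolute column sum. -/
def normOneM {d e : Type*} [Fintype d] [Fintype e] (M : Matrix d e ℝ) : ℝ :=
  ⨆ j, ∑ i, |M i j|

/-- The `p`-norm of a finite-dimensional real vector, `1 ≤ p ≤ ∞`. -/
def vecPNorm {d : Type*} [Fintype d] (p : ℝ≥0∞) (v : d → ℝ) : ℝ :=
  if p = ⊤ then ⨆ i, |v i| else (∑ i, |v i| ^ p.toReal) ^ (1 / p.toReal)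

/-- The induced matrix `p`-norm `‖M‖_p = sup_{‖v‖_p = 1} ‖Mv‖_p`. -/
def inducedPNorm {d : Type*} [Fintype d] (p : ℝ≥0∞) (M : Matrix d d ℝ) : ℝ :=
  sSup {r | ∃ v : d → ℝ, vecPNorm p v = 1 ∧ r = vecPNorm p (M.mulVec v)}

/-- The operator norm of the Hankel operator of `f` on `ℓ²`. -/
def hankelOpNorm {S : Type*} (f : List S → ℝ) : ℝ :=
  sSup {r | ∃ g : List S → ℝ, (Summable fun y => g y ^ 2) ∧ (∑' y, g y ^ 2) ≤ 1 ∧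
    (Summable fun x : List S => (∑' y : List S, f (x ++ y) * g y) ^ 2) ∧
    r = Real.sqrt (∑' x : List S, (∑' y : List S, f (x ++ y) * g y) ^ 2)}

end

open Filter Topology

namespace WFA

variable {S : Type*} {n : ℕ}

lemma matOf_nil (M : WFA S n) : M.matOf [] = 1 := rfl

lemma matOf_cons (M : WFA S n) (a : S) (x : List S) :
    M.matOf (a :: x) = M.trans a * M.matOf x := by
  simp [matOf]

lemma matOf_append (M : WFA S n) (x y : List S) :
    M.matOf (x ++ y) = M.matOf x * M.matOf y := by
  simp [matOf]

lemma bwd_cons (M : WFA S n) (a : S) (x : List S) :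
    M.bwd (a :: x) = M.trans a *ᵥ M.bwd x := by
  simp [bwd, matOf_cons, Matrix.mulVec_mulVec]

lemma f_append_append (M : WFA S n) (x z y : List S) :
    M.f (x ++ z ++ y) = M.fwd x ⬝ᵥ M.matOf z *ᵥ M.bwd y := by
  simp only [f, fwd, bwd, matOf_append, ← Matrix.mulVec_mulVec, Matrix.dotProduct_mulVec]

/-- The automaton computing `x ↦ f x.reverse`. -/
def rev (M : WFA S n) : WFA S n := ⟨M.final, M.init, fun a => (M.trans a)ᵀ⟩

lemma matOf_rev (M : WFA S n) (x : List S) : M.rev.matOf x = (M.matOf x.reverse)ᵀ := by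
  induction x with
  | nil => simp [matOf_nil]
  | cons a x ih =>
    rw [matOf_cons, ih, List.reverse_cons, matOf_append, Matrix.transpose_mul]
    simp [matOf, rev]

lemma bwd_rev (M : WFA S n) (x : List S) : M.rev.bwd x = M.fwd x.reverse := by
  rw [bwd, matOf_rev, Matrix.mulVec_transpose]
  rfl

lemma f_rev (M : WFA S n) (x : List S) : M.rev.f x = M.f x.reverse := by
  simp only [f, matOf_rev]
  simp only [rev, Matrix.mulVec_transpose]
  rw [dotProduct_comm, Matrix.dotProduct_mulVec]

lemma Min.rev {M : WFA S n} (h : M.Min) : M.rev.Min := by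
  rintro m ⟨B, hB⟩
  refine h m ⟨B.rev, funext fun x => ?_⟩
  rw [f_rev, hB, f_rev, List.reverse_reverse]

/-- In a minimal automaton the backward vectors span the state space. -/
lemma Min.span_bwd {M : WFA S n} (h : M.Min) : Submodule.span ℝ (Set.range M.bwd) = ⊤ := by
  set W := Submodule.span ℝ (Set.range M.bwd) with hW
  have hbwd : ∀ x, M.bwd x ∈ W := fun x => Submodule.subset_span ⟨x, rfl⟩
  have htrans : ∀ a, ∀ w ∈ W, M.trans a *ᵥ w ∈ W := by
    intro a
    change W ≤ W.comap (M.trans a).mulVecLin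
    rw [hW, Submodule.span_le]
    rintro _ ⟨x, rfl⟩
    change M.trans a *ᵥ M.bwd x ∈ W
    rw [← bwd_cons]
    exact hbwd _
  let b := Module.finBasis ℝ W
  let P : Matrix (Fin n) (Fin (Module.finrank ℝ W)) ℝ := Matrix.of fun i j => (b j : Fin n → ℝ) i
  have hP : ∀ w (hw : w ∈ W), P *ᵥ (b.repr ⟨w, hw⟩) = w := by
    intro w hw
    have := congrArg (Subtype.val) (b.sum_repr ⟨w, hw⟩)
    ext i
    have := congrFun this i
    simp only [AddSubmonoidClass.coe_finsetSum, Submodule.coe_smul, Finset.sum_apply,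
      Pi.smul_apply, smul_eq_mul] at this
    simp only [Matrix.mulVec, dotProduct, P, Matrix.of_apply]
    simpa [mul_comm] using this
  let B : WFA S (Module.finrank ℝ W) :=
    { init := M.init ᵥ* P
      final := b.repr ⟨M.bwd [], hbwd []⟩
      trans := fun a => Matrix.of fun i j => b.repr ⟨_, htrans a (b j) (b j).2⟩ i }
  have hcomm : ∀ a, P * B.trans a = M.trans a * P := by
    intro a
    ext i j
    exact congrFun (hP _ (htrans a (b j) (b j).2)) i
  have hmat : ∀ x, P * B.matOf x = M.matOf x * P := by
    intro x
    induction x with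
    | nil => simp [matOf_nil]
    | cons a x ih =>
      rw [matOf_cons, matOf_cons, ← Matrix.mul_assoc, hcomm, Matrix.mul_assoc, ih,
        Matrix.mul_assoc]
  have hf : B.f = M.f := by
    funext x
    have hfin : P *ᵥ B.final = M.final :=
      (hP _ (hbwd [])).trans (by simp [bwd, matOf_nil])
    calc B.f x = M.init ⬝ᵥ (P * B.matOf x) *ᵥ B.final := by
          simp only [f, B, ← Matrix.mulVec_mulVec, Matrix.dotProduct_mulVec]
      _ = M.f x := by rw [hmat, ← Matrix.mulVec_mulVec, hfin, f]
  have hle := h _ ⟨B, hf⟩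
  apply Submodule.eq_top_of_finrank_eq
  refine le_antisymm (Submodule.finrank_le W) ?_
  simpa using hle

/-- In a minimal automaton the forward vectors span the state space. -/
lemma Min.span_fwd {M : WFA S n} (h : M.Min) : Submodule.span ℝ (Set.range M.fwd) = ⊤ := by
  rw [← h.rev.span_bwd]
  congr 1
  have : M.rev.bwd = M.fwd ∘ List.reverse := funext M.bwd_rev
  rw [this, List.reverse_surjective.range_comp]

lemma sum_matOf_ofFn [Fintype S] (M : WFA S n) (k : ℕ) :
    ∑ x : Fin k → S, M.matOf (List.ofFn x) = (∑ a, M.trans a) ^ k := by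
  induction k with
  | zero => simp [matOf_nil]
  | succ k ih =>
    rw [← (Fin.consEquiv fun _ => S).sum_comp, Fintype.sum_prod_type, pow_succ', ← ih,
      Finset.sum_mul_sum]
    simp [Fin.consEquiv, List.ofFn_succ, matOf_cons]

lemma sum_f_append_append [Fintype S] (M : WFA S n) (x y : List S) (k : ℕ) :
    ∑ z : Fin k → S, M.f (x ++ List.ofFn z ++ y) =
      M.fwd x ⬝ᵥ ((∑ a, M.trans a) ^ k) *ᵥ M.bwd y := by
  simp only [f_append_append, ← sum_matOf_ofFn, Matrix.sum_mulVec, dotProduct_sum]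

end WFA

lemma summable_list_iff {S : Type*} [Fintype S] {h : List S → ℝ} (h0 : ∀ x, 0 ≤ h x) :
    Summable h ↔ Summable fun k => ∑ x : Fin k → S, h (List.ofFn x) := by
  rw [← List.equivSigmaTuple.symm.summable_iff,
    summable_sigma_of_nonneg (f := h ∘ List.equivSigmaTuple.symm) fun _ => h0 _]
  simp only [Function.comp_apply, List.equivSigmaTuple_symm_apply, tsum_fintype]
  exact and_iff_right fun _ => Summable.of_finite

section Matrix

variable {d : Type*} [Fintype d] [DecidableEq d]

attribute [local instance] Matrix.linftyOpNormedRing Matrix.linftyOpNormedAlgebra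

lemma specRad_lt_one_of_tendsto_pow {T : Matrix d d ℝ}
    (h : Tendsto (fun k => T ^ k) atTop (𝓝 0)) : specRad T < 1 := by
  have hC : Tendsto (fun k => (T.map (algebraMap ℝ ℂ)) ^ k) atTop (𝓝 0) := by
    have hc : Continuous fun A : Matrix d d ℝ => A.map (algebraMap ℝ ℂ) :=
      continuous_id.matrix_map Complex.continuous_ofReal
    have := (hc.tendsto 0).comp h
    rw [Matrix.map_zero _ (map_zero _)] at this
    exact this.congr fun k => Matrix.map_pow T (algebraMap ℝ ℂ) k
  have hn := (hC.nnnorm).mul_const ‖(1 : Matrix d d ℂ)‖₊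
  rw [nnnorm_zero, zero_mul] at hn
  obtain ⟨k, hk1, hk⟩ := ((hn.eventually_lt_const one_pos).and (eventually_ge_atTop 1)).exists
  have hpow : specRad T ^ k < 1 :=
    calc specRad T ^ k ≤ spectralRadius ℂ ((T.map (algebraMap ℝ ℂ)) ^ k) :=
          spectrum.spectralRadius_pow_le _ _ (by omega)
      _ ≤ ‖(T.map (algebraMap ℝ ℂ)) ^ k‖₊ * ‖(1 : Matrix d d ℂ)‖₊ :=
          iSup₂_le fun z hz => by exact_mod_cast spectrum.norm_le_norm_mul_of_mem hz
      _ < 1 := by exact_mod_cast hk1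
  exact lt_of_not_ge fun h1 => absurd hpow (not_lt.2 (one_le_pow₀ h1))

lemma summable_pow_of_specRad_lt_one {T : Matrix d d ℝ} (h : specRad T < 1) :
    Summable fun k => T ^ k := by
  obtain ⟨r, hr, hr1⟩ := ENNReal.lt_iff_exists_nnreal_btwn.1 h
  have hC : Summable fun k => (T.map (algebraMap ℝ ℂ)) ^ k := by
    refine Summable.of_norm_bounded_eventually_nat
      (NNReal.summable_coe.2 (NNReal.summable_geometric (by exact_mod_cast hr1))) ?_
    filter_upwards [(spectrum.pow_nnnorm_pow_one_div_tendsto_nhds_spectralRadius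
      (T.map (algebraMap ℝ ℂ))).eventually_lt_const hr, eventually_ge_atTop 1] with k hk hk1
    have := ENNReal.rpow_le_rpow hk.le (Nat.cast_nonneg (α := ℝ) k)
    rw [← ENNReal.rpow_mul, one_div, inv_mul_cancel₀ (by positivity), ENNReal.rpow_one,
      ENNReal.rpow_natCast] at this
    exact_mod_cast this
  have hc : Continuous (Complex.reCLM.toLinearMap.toAddMonoidHom.mapMatrix (m := d) (n := d)) :=
    continuous_id.matrix_map Complex.continuous_re
  refine (hC.map _ hc).congr fun k => ?_
  rw [Function.comp_apply, ← Matrix.map_pow]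
  ext i j
  simp

end Matrix

/-- if `B` is a minimal WFA computing `f_A²`, then `f_A ∈ ℓ²` iff
`ρ(∑_σ B_σ) < 1`. -/
theorem ell_two_iff_spectral_radius_of_square {S : Type*} [Fintype S] {n m : ℕ}
    (M : WFA S n) (B : WFA S m)
    (hB : ∀ x : List S, B.f x = (M.f x) ^ 2) (hmin : B.Min) :
    (Summable fun x : List S => M.f x ^ 2) ↔ specRad (∑ a : S, B.trans a) < 1 := by
  have h0 : ∀ x, 0 ≤ B.f x := fun x => (hB x).symm ▸ sq_nonneg _
  simp only [← hB]
  set T := ∑ a, B.trans a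
  constructor
  · intro hs
    apply specRad_lt_one_of_tendsto_pow
    have hFB : ∀ x y, Tendsto (fun k => B.fwd x ⬝ᵥ (T ^ k) *ᵥ B.bwd y) atTop (𝓝 0) := by
      intro x y
      have hinj : Function.Injective fun z : List S => x ++ z ++ y := fun z w hzw => by
        simpa using hzw
      have := ((summable_list_iff fun z => h0 (x ++ z ++ y)).1
        (hs.comp_injective hinj)).tendsto_atTop_zero
      simpa only [B.sum_f_append_append] using this
    have hF : ∀ x v, Tendsto (fun k => B.fwd x ⬝ᵥ (T ^ k) *ᵥ v) atTop (𝓝 0) := by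
      intro x v
      have hv : v ∈ Submodule.span ℝ (Set.range B.bwd) := hmin.span_bwd ▸ Submodule.mem_top
      induction hv using Submodule.span_induction with
      | mem v hv => obtain ⟨y, rfl⟩ := hv; exact hFB x y
      | zero => simp
      | add v w _ _ hv hw => simpa [Matrix.mulVec_add] using hv.add hw
      | smul c v _ hv => simpa [Matrix.mulVec_smul] using hv.const_mul c
    have hall : ∀ u v, Tendsto (fun k => u ⬝ᵥ (T ^ k) *ᵥ v) atTop (𝓝 0) := by
      intro u v
      have hu : u ∈ Submodule.span ℝ (Set.range B.fwd) := hmin.span_fwd ▸ Submodule.mem_top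
      induction hu using Submodule.span_induction with
      | mem u hu => obtain ⟨x, rfl⟩ := hu; exact hF x v
      | zero => simp
      | add u w _ _ hu hw => simpa [add_dotProduct] using hu.add hw
      | smul c u _ hu => simpa [smul_dotProduct] using hu.const_mul c
    refine tendsto_pi_nhds.2 fun i => tendsto_pi_nhds.2 fun j => ?_
    simpa using hall (Pi.single i 1) (Pi.single j 1)
  · intro h
    rw [summable_list_iff h0]
    let φ : Matrix (Fin m) (Fin m) ℝ →+ ℝ :=
      { toFun := fun A => B.fwd [] ⬝ᵥ A *ᵥ B.bwd []
        map_zero' := by simp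
        map_add' := by simp [Matrix.add_mulVec] }
    have hφ : Continuous φ :=
      continuous_const.dotProduct (continuous_id.matrix_mulVec continuous_const)
    refine ((summable_pow_of_specRad_lt_one h).map φ hφ).congr fun k => ?_
    refine (B.sum_f_append_append [] [] k).symm.trans ?_
    simp
end

section
/- Let A = ⟨α, β, {A_a}⟩ be a WFA over a finite alphabet Σ computing a rational function f. Then: (1) if the observability Gramian G_s is well-defined, Σ_{x∈Σ*} f(x)² = αᵀ G_s α; (2) if the reachability Gramian G_p is well-defined, Σ_{x∈Σ*} f(x)² = βᵀ G_p β; (3) if both Gramians are well-defined, the operator norm of the Hankel operator satisfies ‖H_f‖_op² = ρ(G_p G_s) and its Hilbert–Schmidt (Frobenius) norm satisfies Σ_{p,s∈Σ*} f(ps)² = Tr(G_p G_s). -/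
open scoped ENNReal
open scoped Kronecker
open Matrix

section SpectralRadius

variable {d : Type*} [Fintype d] [DecidableEq d]

lemma specRad_congr_charpoly {A B : Matrix d d ℝ} (h : A.charpoly = B.charpoly) :
    specRad A = specRad B := by
  have hs : spectrum ℂ (A.map (algebraMap ℝ ℂ)) = spectrum ℂ (B.map (algebraMap ℝ ℂ)) := by
    ext z
    rw [mem_spectrum_iff_isRoot_charpoly, mem_spectrum_iff_isRoot_charpoly, charpoly_map,
      charpoly_map, h]
  simp only [specRad, spectralRadius, hs]

lemma specRad_mul_comm (A B : Matrix d d ℝ) : specRad (A * B) = specRad (B * A) :=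
  specRad_congr_charpoly (charpoly_mul_comm A B)

lemma Matrix.IsHermitian.spectrum_map_complex {A : Matrix d d ℝ} (hA : A.IsHermitian) :
    spectrum ℂ (A.map (algebraMap ℝ ℂ)) = Set.range fun i => (hA.eigenvalues i : ℂ) := by
  ext z
  rw [mem_spectrum_iff_isRoot_charpoly, charpoly_map, hA.charpoly_eq]
  simp [Polynomial.IsRoot, Polynomial.eval_map, Polynomial.eval₂_finsetProd,
    Finset.prod_eq_zero_iff, sub_eq_zero, eq_comm (a := z)]

lemma Matrix.IsHermitian.dotProduct_mulVec_le {A : Matrix d d ℝ} (hA : A.IsHermitian) {c : ℝ}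
    (hc : ∀ i, hA.eigenvalues i ≤ c) (w : d → ℝ) : w ⬝ᵥ A *ᵥ w ≤ c * (w ⬝ᵥ w) := by
  have key (x y : d → ℝ) : x ⬝ᵥ y =
      ∑ i, (⇑(hA.eigenvectorBasis i) ⬝ᵥ x) * (⇑(hA.eigenvectorBasis i) ⬝ᵥ y) := by
    have h := hA.eigenvectorBasis.sum_inner_mul_inner (WithLp.toLp 2 x) (WithLp.toLp 2 y)
    simp only [EuclideanSpace.inner_eq_star_dotProduct, star_trivial] at h
    rw [dotProduct_comm, ← h]
    exact Finset.sum_congr rfl fun i _ => by rw [dotProduct_comm y]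
  have hsymm : Aᵀ = A := by simpa using hA.eq
  rw [key w (A *ᵥ w), key w w, Finset.mul_sum]
  refine Finset.sum_le_sum fun i _ => ?_
  rw [dotProduct_mulVec, ← mulVec_transpose, hsymm, hA.mulVec_eigenvectorBasis, smul_dotProduct,
    smul_eq_mul, mul_left_comm]
  exact mul_le_mul_of_nonneg_right (hc i) (mul_self_nonneg _)

/-- The spectral radius of a real positive semidefinite matrix bounds its quadratic form, and is an
eigenvalue unless it vanishes. -/
lemma Matrix.PosSemidef.exists_specRad_eq {A : Matrix d d ℝ} (hA : A.PosSemidef) :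
    ∃ c : ℝ, 0 ≤ c ∧ specRad A = ENNReal.ofReal c ∧
      (∀ w, w ⬝ᵥ A *ᵥ w ≤ c * (w ⬝ᵥ w)) ∧
      (c = 0 ∨ ∃ u : d → ℝ, u ⬝ᵥ u = 1 ∧ A *ᵥ u = c • u) := by
  have hnn := hA.eigenvalues_nonneg
  have hle (i : d) : hA.isHermitian.eigenvalues i ≤ ⨆ j, hA.isHermitian.eigenvalues j :=
    le_ciSup (Set.finite_range _).bddAbove i
  have hrad : specRad A = ⨆ i, ENNReal.ofReal (hA.isHermitian.eigenvalues i) := by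
    rw [specRad, spectralRadius, hA.isHermitian.spectrum_map_complex, iSup_range]
    refine iSup_congr fun i => ?_
    rw [← enorm_eq_nnnorm, ← ofReal_norm, Complex.norm_real,
      Real.norm_of_nonneg (hnn i)]
  refine ⟨⨆ i, hA.isHermitian.eigenvalues i, Real.iSup_nonneg hnn, ?_,
    hA.isHermitian.dotProduct_mulVec_le hle, ?_⟩
  · rw [hrad]
    rcases isEmpty_or_nonempty d with _ | _
    · simp
    · obtain ⟨i, hi⟩ := exists_eq_ciSup_of_finite (f := hA.isHermitian.eigenvalues)
      exact le_antisymm (iSup_le fun j => ENNReal.ofReal_le_ofReal (hle j))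
        (hi ▸ le_iSup (fun j => ENNReal.ofReal (hA.isHermitian.eigenvalues j)) i)
  · rcases isEmpty_or_nonempty d with _ | _
    · simp
    · obtain ⟨i, hi⟩ := exists_eq_ciSup_of_finite (f := hA.isHermitian.eigenvalues)
      refine .inr ⟨⇑(hA.isHermitian.eigenvectorBasis i), ?_, ?_⟩
      · have h := inner_self_eq_norm_sq_to_K (𝕜 := ℝ) (hA.isHermitian.eigenvectorBasis i)
        rw [EuclideanSpace.inner_eq_star_dotProduct, star_trivial,
          (hA.isHermitian.eigenvectorBasis).norm_eq_one] at h
        simpa using h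
      · rw [hA.isHermitian.mulVec_eigenvectorBasis, hi]

open scoped MatrixOrder Matrix.Norms.L2Operator in
lemma Matrix.PosSemidef.exists_eq_transpose_mul_self {A : Matrix d d ℝ} (hA : A.PosSemidef) :
    ∃ R : Matrix d d ℝ, A = Rᵀ * R := by
  obtain ⟨R, hR⟩ := CStarAlgebra.nonneg_iff_eq_star_mul_self.mp hA.nonneg
  exact ⟨R, by rw [hR, star_eq_conjTranspose, conjTranspose_eq_transpose_of_trivial]⟩

end SpectralRadius

section Gram

variable {ι κ d : Type*}

/-- The Gram matrix of the columns of the (infinite) matrix with rows `a x`. -/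
noncomputable def rowGram (a : ι → d → ℝ) : Matrix d d ℝ :=
  Matrix.of fun i j => ∑' x, a x i * a x j

lemma rowGram_transpose (a : ι → d → ℝ) : (rowGram a)ᵀ = rowGram a := by
  ext i j
  simp [rowGram, mul_comm]

variable [Fintype d]

lemma hasSum_dotProduct_mul {a : ι → d → ℝ} (ha : ∀ i j, Summable fun x => a x i * a x j)
    (v : d → ℝ) (i : d) : HasSum (fun x => (a x ⬝ᵥ v) * a x i) ((rowGram a *ᵥ v) i) := by
  have h := hasSum_sum (s := Finset.univ) fun j _ => (ha i j).hasSum.mul_right (v j)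
  refine (congrArg (HasSum · _) (funext fun x => ?_)).mpr h
  rw [dotProduct, Finset.sum_mul]
  exact Finset.sum_congr rfl fun j _ => by ring

lemma hasSum_dotProduct_sq {a : ι → d → ℝ} (ha : ∀ i j, Summable fun x => a x i * a x j)
    (v : d → ℝ) : HasSum (fun x => (a x ⬝ᵥ v) ^ 2) (v ⬝ᵥ rowGram a *ᵥ v) := by
  have h := hasSum_sum (s := Finset.univ) fun i _ => (hasSum_dotProduct_mul ha v i).mul_left (v i)
  refine (congrArg (HasSum · _) (funext fun x => ?_)).mpr h
  rw [sq, dotProduct, Finset.mul_sum]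
  exact Finset.sum_congr rfl fun j _ => by ring

lemma rowGram_posSemidef {a : ι → d → ℝ} (ha : ∀ i j, Summable fun x => a x i * a x j) :
    (rowGram a).PosSemidef := by
  refine .of_dotProduct_mulVec_nonneg ?_ fun v => ?_
  · rw [IsHermitian, conjTranspose_eq_transpose_of_trivial, rowGram_transpose]
  · rw [star_trivial]
    exact (hasSum_dotProduct_sq ha v).nonneg fun x => sq_nonneg _

lemma summable_mul_of_summable_sq {g h : ι → ℝ} (hg : Summable fun x => g x ^ 2)
    (hh : Summable fun x => h x ^ 2) : Summable fun x => g x * h x := by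
  refine .of_norm_bounded (hg.add hh) fun x => ?_
  rw [Real.norm_eq_abs, abs_le]
  constructor <;> nlinarith [sq_nonneg (g x + h x), sq_nonneg (g x - h x)]

lemma tsum_mul_sq_le {g h : ι → ℝ} (hg : Summable fun x => g x ^ 2)
    (hg1 : ∑' x, g x ^ 2 ≤ 1) (hh : Summable fun x => h x ^ 2) :
    (∑' x, g x * h x) ^ 2 ≤ ∑' x, h x ^ 2 := by
  set t := ∑' x, g x * h x with ht
  have hgh := (summable_mul_of_summable_sq hg hh).hasSum
  rw [← ht] at hgh
  have key := (hh.hasSum.sub (hgh.mul_left (2 * t))).add (hg.hasSum.mul_left (t ^ 2))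
  have hnn := key.nonneg fun x => by nlinarith [sq_nonneg (h x - t * g x)]
  nlinarith [mul_le_mul_of_nonneg_left hg1 (sq_nonneg t)]

/-- The column combination `∑ y, g y • b y` of the rows of an infinite matrix. -/
noncomputable def rowComb (b : κ → d → ℝ) (g : κ → ℝ) : d → ℝ := fun i => ∑' y, g y * b y i

lemma hasSum_mul_dotProduct {b : κ → d → ℝ} (hb : ∀ i j, Summable fun y => b y i * b y j)
    {g : κ → ℝ} (hg : Summable fun y => g y ^ 2) (v : d → ℝ) :
    HasSum (fun y => g y * (b y ⬝ᵥ v)) (rowComb b g ⬝ᵥ v) := by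
  have hs (i : d) : Summable fun y => g y * b y i :=
    summable_mul_of_summable_sq hg (by simpa only [sq] using hb i i)
  have h := hasSum_sum (s := Finset.univ) fun i _ => (hs i).hasSum.mul_right (v i)
  refine (congrArg (HasSum · _) (funext fun y => ?_)).mpr h
  rw [dotProduct, Finset.mul_sum]
  exact Finset.sum_congr rfl fun i _ => by ring

lemma tsum_dotProduct_sq_eq_trace {a : ι → d → ℝ} {b : κ → d → ℝ}
    (ha : ∀ i j, Summable fun x => a x i * a x j)
    (hb : ∀ i j, Summable fun y => b y i * b y j) :
    ∑' p : ι × κ, (a p.1 ⬝ᵥ b p.2) ^ 2 = (rowGram a * rowGram b).trace := by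
  have hs (i j : d) : HasSum (fun p : ι × κ => (a p.1 i * a p.1 j) * (b p.2 j * b p.2 i))
      (rowGram a i j * rowGram b j i) := by
    have h := (summable_mul_of_summable_norm (ha i j).norm (hb j i).norm).hasSum
    rwa [← tsum_mul_tsum_of_summable_norm (ha i j).norm (hb j i).norm] at h
  have h := hasSum_sum (s := Finset.univ) fun i _ =>
    hasSum_sum (s := Finset.univ) fun j _ => hs i j
  have hfun (p : ι × κ) : (a p.1 ⬝ᵥ b p.2) ^ 2 =
      ∑ i, ∑ j, (a p.1 i * a p.1 j) * (b p.2 j * b p.2 i) := by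
    rw [sq, dotProduct, Finset.sum_mul_sum]
    exact Finset.sum_congr rfl fun i _ => Finset.sum_congr rfl fun j _ => by ring
  simp_rw [hfun]
  rw [h.tsum_eq]
  rfl

variable [DecidableEq d]

/-- The squared norm of the operator with matrix `a x ⬝ᵥ b y` is the spectral radius of
the product of the two Gram matrices. -/
lemma specRad_rowGram_mul_rowGram {a : ι → d → ℝ} {b : κ → d → ℝ}
    (ha : ∀ i j, Summable fun x => a x i * a x j)
    (hb : ∀ i j, Summable fun y => b y i * b y j) :
    specRad (rowGram a * rowGram b) = ENNReal.ofReal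
      (sSup {r | ∃ g : κ → ℝ, (Summable fun y => g y ^ 2) ∧ (∑' y, g y ^ 2) ≤ 1 ∧
        (Summable fun x => (∑' y, (a x ⬝ᵥ b y) * g y) ^ 2) ∧
        r = √(∑' x, (∑' y, (a x ⬝ᵥ b y) * g y) ^ 2)} ^ 2) := by
  obtain ⟨R, hR⟩ := (rowGram_posSemidef ha).exists_eq_transpose_mul_self
  have hpsd : (R * rowGram b * Rᵀ).PosSemidef := by
    simpa using (rowGram_posSemidef hb).mul_mul_conjTranspose_same R
  obtain ⟨c, hc0, hcrad, hcle, hceig⟩ := hpsd.exists_specRad_eq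
  have hrad : specRad (rowGram a * rowGram b) = ENNReal.ofReal c := by
    rw [hR, Matrix.mul_assoc, specRad_mul_comm, hcrad]
  have happly {g : κ → ℝ} (hg : Summable fun y => g y ^ 2) (x : ι) :
      ∑' y, (a x ⬝ᵥ b y) * g y = a x ⬝ᵥ rowComb b g := by
    rw [dotProduct_comm, ← (hasSum_mul_dotProduct hb hg (a x)).tsum_eq]
    exact tsum_congr fun y => by rw [dotProduct_comm, mul_comm]
  have hquad (v : d → ℝ) : v ⬝ᵥ rowGram a *ᵥ v = (R *ᵥ v) ⬝ᵥ (R *ᵥ v) := by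
    rw [hR, ← mulVec_mulVec, dotProduct_mulVec, vecMul_transpose]
  have hupper {g : κ → ℝ} (hg : Summable fun y => g y ^ 2) (hg1 : ∑' y, g y ^ 2 ≤ 1) :
      (R *ᵥ rowComb b g) ⬝ᵥ (R *ᵥ rowComb b g) ≤ c := by
    set v := rowComb b g with hv
    set w := R *ᵥ v with hw
    have hz := hasSum_dotProduct_sq hb (Rᵀ *ᵥ w)
    have hcs := tsum_mul_sq_le hg hg1 hz.summable
    rw [(hasSum_mul_dotProduct hb hg (Rᵀ *ᵥ w)).tsum_eq, hz.tsum_eq, ← hv,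
      dotProduct_mulVec v, vecMul_transpose, ← hw] at hcs
    have hform : (Rᵀ *ᵥ w) ⬝ᵥ rowGram b *ᵥ (Rᵀ *ᵥ w) = w ⬝ᵥ (R * rowGram b * Rᵀ) *ᵥ w := by
      rw [← mulVec_mulVec, ← mulVec_mulVec, dotProduct_mulVec w R, ← mulVec_transpose]
    rw [hform] at hcs
    have hle := hcs.trans (hcle w)
    have hw0 : 0 ≤ w ⬝ᵥ w := Finset.sum_nonneg fun i _ => mul_self_nonneg _
    by_contra! hlt
    nlinarith
  have hbound : √c ∈ upperBounds {r | ∃ g : κ → ℝ, (Summable fun y => g y ^ 2) ∧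
      (∑' y, g y ^ 2) ≤ 1 ∧ (Summable fun x => (∑' y, (a x ⬝ᵥ b y) * g y) ^ 2) ∧
        r = √(∑' x, (∑' y, (a x ⬝ᵥ b y) * g y) ^ 2)} := by
    rintro r ⟨g, hg, hg1, -, rfl⟩
    simp_rw [happly hg]
    rw [(hasSum_dotProduct_sq ha _).tsum_eq, hquad]
    exact Real.sqrt_le_sqrt (hupper hg hg1)
  rw [hrad]
  congr 1
  rw [← Real.sq_sqrt hc0]
  congr 1
  refine le_antisymm ?_ (Real.sSup_le hbound (Real.sqrt_nonneg _))
  rcases hc0.eq_or_lt with rfl | hcpos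
  · rw [Real.sqrt_zero]
    refine Real.sSup_nonneg ?_
    rintro r ⟨g, -, -, -, rfl⟩
    exact Real.sqrt_nonneg _
  obtain ⟨u, hu, hAu⟩ := hceig.resolve_left hcpos.ne'
  refine le_csSup ⟨_, hbound⟩ ?_
  set z := (√c)⁻¹ • Rᵀ *ᵥ u with hz
  have hss : (√c)⁻¹ * (√c)⁻¹ * c = 1 := by
    rw [← mul_inv, Real.mul_self_sqrt hc0, inv_mul_cancel₀ hcpos.ne']
  have hRG : R *ᵥ rowGram b *ᵥ z = (√c)⁻¹ • c • u := by
    rw [hz, mulVec_smul, mulVec_smul, mulVec_mulVec, mulVec_mulVec, hAu]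
  have hg := hasSum_dotProduct_sq hb z
  have hg1 : z ⬝ᵥ rowGram b *ᵥ z = 1 := by
    nth_rewrite 1 [hz]
    rw [smul_dotProduct, mulVec_transpose, ← dotProduct_mulVec, hRG]
    simp only [dotProduct_smul, hu, smul_eq_mul, mul_one]
    rw [← mul_assoc, hss]
  have hcomb : rowComb b (fun y => b y ⬝ᵥ z) = rowGram b *ᵥ z :=
    funext fun i => (hasSum_dotProduct_mul hb z i).tsum_eq
  have hval := hasSum_dotProduct_sq ha (rowGram b *ᵥ z)
  rw [hquad, hRG] at hval
  have hc : ((√c)⁻¹ • c • u) ⬝ᵥ ((√c)⁻¹ • c • u) = c := by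
    simp only [dotProduct_smul, smul_dotProduct, hu, smul_eq_mul, mul_one]
    linear_combination c * hss
  rw [hc] at hval
  refine ⟨fun y => b y ⬝ᵥ z, hg.summable, (hg.tsum_eq.trans hg1).le, ?_, ?_⟩
  · simp_rw [happly hg.summable, hcomb]
    exact hval.summable
  · simp_rw [happly hg.summable, hcomb]
    rw [hval.tsum_eq]

end Gram

namespace WFA

variable {S : Type*} {n : ℕ}

lemma f_append (M : WFA S n) (x y : List S) : M.f (x ++ y) = M.fwd x ⬝ᵥ M.bwd y := by
  rw [f, matOf, List.map_append, List.prod_append, ← mulVec_mulVec, dotProduct_mulVec]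
  rfl

lemma f_eq_bwd_dotProduct (M : WFA S n) (x : List S) : M.f x = M.bwd x ⬝ᵥ M.init :=
  dotProduct_comm _ _

lemma f_eq_fwd_dotProduct (M : WFA S n) (x : List S) : M.f x = M.fwd x ⬝ᵥ M.final :=
  dotProduct_mulVec _ _ _

lemma Gp_eq_rowGram (M : WFA S n) : M.Gp = rowGram M.fwd := rfl

lemma Gs_eq_rowGram (M : WFA S n) : M.Gs = rowGram M.bwd := rfl

end WFA

/-- Gramian formulas: `‖f‖₂² = αᵀ G_s α = βᵀ G_p β`,
`‖H_f‖_op² = ρ(G_p G_s)` and `‖H_f‖_HS² = Tr(G_p G_s)`. -/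
theorem gramian_norm_formulas {S : Type*} [Fintype S] {n : ℕ} (M : WFA S n)
    (f : List S → ℝ) (hf : M.f = f) :
    (M.GsDefined → (∑' x : List S, f x ^ 2) = M.init ⬝ᵥ (M.Gs.mulVec M.init)) ∧
    (M.GpDefined → (∑' x : List S, f x ^ 2) = M.final ⬝ᵥ (M.Gp.mulVec M.final)) ∧
    (M.GpDefined → M.GsDefined →
      specRad (M.Gp * M.Gs) = ENNReal.ofReal (hankelOpNorm f ^ 2) ∧
      (∑' ps : List S × List S, f (ps.1 ++ ps.2) ^ 2) = (M.Gp * M.Gs).trace) := by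
  subst hf
  rw [M.Gp_eq_rowGram, M.Gs_eq_rowGram]
  refine ⟨fun hs => ?_, fun hp => ?_, fun hp hs => ⟨?_, ?_⟩⟩
  · simp_rw [M.f_eq_bwd_dotProduct]
    exact (hasSum_dotProduct_sq hs M.init).tsum_eq
  · simp_rw [M.f_eq_fwd_dotProduct]
    exact (hasSum_dotProduct_sq hp M.final).tsum_eq
  · simp_rw [hankelOpNorm, M.f_append]
    exact specRad_rowGram_mul_rowGram hp hs
  · simp_rw [M.f_append]
    exact tsum_dotProduct_sq_eq_trace hp hs
end
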